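/- arXiv:math/0406523 — 2 statements merged into one kernel-verified Lean document; each statement's English description precedes it below -/
import Mathlib

section
/- Suppose F satisfies the second-order tail conditions with α_R < 2 and α_L > 2. Then there is a strictly positive finite constant C_R, depending only on c_R and α_R, such that σ²(m/n, k/n) / (k/n)^{1−2/α_R} → C_R as n → ∞. -/
open Filter Set Topology MeasureTheory

/-- The generalized inverse (quantile function) of a distribution function `F`:
`F⁻(u) = inf {x : F x ≥ u}`. -/
noncomputable def quantile (F : ℝ → ℝ) (u : ℝ) : ℝ := sInf {x : ℝ | u ≤ F x}

/-- The Lebesgue–Stieltjes measure associated to a nondecreasing function `g`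
(junk value `0` if `g` is not monotone). -/
noncomputable def lsMeasure (g : ℝ → ℝ) : Measure ℝ :=
  open scoped Classical in
  if hg : Monotone g then hg.stieltjesFunction.measure else 0

/-- The quantile function of `F` clamped to `[s, 1 - t]`: a nondecreasing function of `u`
that agrees with `F⁻` on `[s, 1 - t]`. -/
noncomputable def clampedQuantile (F : ℝ → ℝ) (s t u : ℝ) : ℝ :=
  quantile F (max s (min u (1 - t)))

/-- `σ²(s,t) = ∫_s^{1-t} ∫_s^{1-t} (u ∧ v - u v) dF⁻(u) dF⁻(v)`, the double
Lebesgue–Stieltjes integral over `(s, 1-t]` with respect to the nondecreasing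
function `F⁻`. -/
noncomputable def sigmaSq (F : ℝ → ℝ) (s t : ℝ) : ℝ :=
  ∫ u in Ioc s (1 - t), ∫ v in Ioc s (1 - t), (min u v - u * v)
    ∂(lsMeasure (clampedQuantile F s t)) ∂(lsMeasure (clampedQuantile F s t))

/-- Second-order right-tail condition: as `x → ∞`,
`1 - F x = c * x^(-α) * (1 + b * x^(-β) + o (x^(-β)))`. -/
def RightTailSecondOrder (F : ℝ → ℝ) (c α b β : ℝ) : Prop :=
  Tendsto (fun x : ℝ => ((1 - F x) / (c * x ^ (-α)) - 1) * x ^ β) atTop (nhds b)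

/-- Second-order left-tail condition: as `x → ∞`,
`F (-x) = c * x^(-α) * (1 + b * x^(-β) + o (x^(-β)))`. -/
def LeftTailSecondOrder (F : ℝ → ℝ) (c α b β : ℝ) : Prop :=
  Tendsto (fun x : ℝ => (F (-x) / (c * x ^ (-α)) - 1) * x ^ β) atTop (nhds b)

/-- `F` is a distribution function: nondecreasing, right-continuous, with limits
`0` at `-∞` and `1` at `+∞`. -/
structure IsDistributionFunction (F : ℝ → ℝ) : Prop where
  mono : Monotone F
  right_continuous : ∀ x : ℝ, ContinuousWithinAt F (Ici x) x
  tendsto_atTop : Tendsto F atTop (nhds 1)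
  tendsto_atBot : Tendsto F atBot (nhds 0)

theorem IsDistributionFunction.nonneg {F : ℝ → ℝ} (hF : IsDistributionFunction F) (x : ℝ) :
    0 ≤ F x :=
  hF.mono.le_of_tendsto hF.tendsto_atBot x

theorem IsDistributionFunction.le_one {F : ℝ → ℝ} (hF : IsDistributionFunction F) (x : ℝ) :
    F x ≤ 1 :=
  hF.mono.ge_of_tendsto hF.tendsto_atTop x

theorem quantile_le_of_le {F : ℝ → ℝ} (hF : IsDistributionFunction F) {u x : ℝ} (hu : 0 < u)
    (h : u ≤ F x) : quantile F u ≤ x := by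
  refine csInf_le ?_ h
  obtain ⟨y, hy⟩ := (hF.tendsto_atBot.eventually_lt_const hu).exists
  exact ⟨y, fun z hz => le_of_lt (hF.mono.reflect_lt (hy.trans_le hz))⟩

theorem le_of_quantile_lt {F : ℝ → ℝ} (hF : IsDistributionFunction F) {u x : ℝ} (hu : u < 1)
    (h : quantile F u < x) : u ≤ F x := by
  have hne : {x : ℝ | u ≤ F x}.Nonempty := by
    obtain ⟨y, hy⟩ := (hF.tendsto_atTop.eventually_const_lt hu).exists
    exact ⟨y, hy.le⟩
  obtain ⟨y, hy, hyx⟩ := exists_lt_of_csInf_lt hne h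
  exact le_trans hy (hF.mono hyx.le)

theorem quantile_mono {F : ℝ → ℝ} (hF : IsDistributionFunction F) {u v : ℝ} (hu : 0 < u)
    (hv : v < 1) (huv : u ≤ v) : quantile F u ≤ quantile F v :=
  le_of_forall_gt_imp_ge_of_dense fun _ hx =>
    quantile_le_of_le hF hu (huv.trans (le_of_quantile_lt hF hv hx))

theorem clampedQuantile_monotone {F : ℝ → ℝ} (hF : IsDistributionFunction F) {s t : ℝ}
    (hs : 0 < s) (ht : 0 < t) (hst : s < 1 - t) : Monotone (clampedQuantile F s t) := by
  intro u v huv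
  refine quantile_mono hF (lt_max_of_lt_left hs) (max_lt (by linarith) ?_) ?_
  · exact (min_le_right _ _).trans_lt (by linarith)
  · exact max_le_max le_rfl (min_le_min huv le_rfl)

/-- The Lebesgue–Stieltjes measure of the quantile function is the image of Lebesgue measure
on an interval under `F`. -/
theorem exists_lsMeasure_restrict_eq_map {F : ℝ → ℝ} (hF : IsDistributionFunction F) {s t : ℝ}
    (hs : 0 < s) (ht : 0 < t) (hst : s < 1 - t) :
    ∃ A : ℝ, (∀ x < A, F x ≤ s) ∧
      (lsMeasure (clampedQuantile F s t)).restrict (Ioc s (1 - t)) =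
        (volume.restrict (Ioc A (quantile F (1 - t)))).map F := by
  have hg := clampedQuantile_monotone hF hs ht hst
  set f := hg.stieltjesFunction with hf
  have hμ : lsMeasure (clampedQuantile F s t) = f.measure := by
    simp [lsMeasure, hg, hf]
  have hgt : ∀ a, s ≤ a → a < 1 - t → ∀ x, f a < x → a < F x := by
    intro a hsa hat x hx
    rw [hf, Monotone.stieltjesFunction_eq] at hx
    have h1 : ∀ᶠ b in 𝓝[>] a, clampedQuantile F s t b < x :=
      (hg.tendsto_rightLim a).eventually_lt_const hx
    have h2 : ∀ᶠ b in 𝓝[>] a, b ∈ Ioo a (1 - t) := Ioo_mem_nhdsGT hat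
    obtain ⟨b, hb, hb1, hb2⟩ := (h1.and h2).exists
    rw [clampedQuantile, min_eq_left hb2.le, max_eq_right (by linarith)] at hb
    exact hb1.trans_le (le_of_quantile_lt hF (by linarith) hb)
  have hlt : ∀ a, s ≤ a → a < 1 - t → ∀ x, x < f a → F x ≤ a := by
    intro a hsa hat x hx
    by_contra! h
    rw [hf, Monotone.stieltjesFunction_eq] at hx
    have hab : a < min (F x) (1 - t) := lt_min h hat
    have h3 := hg.rightLim_le hab
    rw [clampedQuantile, min_eq_left (min_le_right _ _), max_eq_right (by linarith)] at h3
    have h4 := quantile_le_of_le hF (by linarith) (min_le_left (F x) (1 - t))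
    linarith
  have hB : f (1 - t) = quantile F (1 - t) := by
    rw [hf, Monotone.stieltjesFunction_eq]
    have : ∀ᶠ b in 𝓝[>] (1 - t), clampedQuantile F s t b = quantile F (1 - t) := by
      filter_upwards [self_mem_nhdsWithin] with b hb
      rw [clampedQuantile, min_eq_right (le_of_lt hb), max_eq_right hst.le]
    exact tendsto_nhds_unique (hg.tendsto_rightLim _) (tendsto_const_nhds.congr' (this.mono fun _ h => h.symm))
  have hltB : ∀ x, x < f (1 - t) → F x < 1 - t := by
    intro x hx
    by_contra! h
    rw [hB] at hx
    exact absurd (quantile_le_of_le hF (by linarith) h) (not_le.2 hx)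
  refine ⟨f s, hlt s le_rfl hst, ?_⟩
  rw [hμ, ← hB]
  have hFm : Measurable F := hF.mono.measurable
  have : IsFiniteMeasure (f.measure.restrict (Ioc s (1 - t))) := by
    constructor
    rw [Measure.restrict_apply_univ, f.measure_Ioc]
    exact ENNReal.ofReal_lt_top
  refine Measure.ext_of_Iic _ _ fun a => ?_
  rw [Measure.restrict_apply measurableSet_Iic, Measure.map_apply hFm measurableSet_Iic,
    Measure.restrict_apply (hFm measurableSet_Iic)]
  rcases lt_or_ge a s with has | hsa
  · have h1 : Iic a ∩ Ioc s (1 - t) = ∅ := by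
      ext x; simp only [mem_inter_iff, mem_Iic, mem_Ioc, mem_empty_iff_false, iff_false]
      rintro ⟨h, h', -⟩; linarith
    have h2 : F ⁻¹' Iic a ∩ Ioc (f s) (f (1 - t)) = ∅ := by
      ext x; simp only [mem_inter_iff, mem_preimage, mem_Iic, mem_Ioc, mem_empty_iff_false, iff_false]
      rintro ⟨h, h', -⟩; linarith [hgt s le_rfl hst x h']
    rw [h1, h2]; simp
  rcases lt_or_ge a (1 - t) with hat | hta
  · have h1 : Iic a ∩ Ioc s (1 - t) = Ioc s a := by
      ext x; simp only [mem_inter_iff, mem_Iic, mem_Ioc]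
      constructor
      · rintro ⟨h, h', -⟩; exact ⟨h', h⟩
      · rintro ⟨h, h'⟩; exact ⟨h', h, by linarith⟩
    rw [h1, f.measure_Ioc]
    have hm : f a ≤ f (1 - t) := f.mono hat.le
    apply le_antisymm
    · rw [← Real.volume_Ioo]
      refine measure_mono fun x hx => ⟨hlt a hsa hat x hx.2, hx.1, (hx.2.le.trans hm)⟩
    · rw [← Real.volume_Ioc]
      refine measure_mono fun x hx => ⟨hx.2.1, ?_⟩
      by_contra! h
      exact absurd hx.1 (not_le.2 (hgt a hsa hat x h))
  · have h1 : Iic a ∩ Ioc s (1 - t) = Ioc s (1 - t) :=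
      inter_eq_right.2 fun x hx => hx.2.trans hta
    rw [h1, f.measure_Ioc]
    apply le_antisymm
    · rw [← Real.volume_Ioo]
      exact measure_mono fun x hx => ⟨(hltB x hx.2).le.trans hta, hx.1, hx.2.le⟩
    · rw [← Real.volume_Ioc]
      exact measure_mono inter_subset_right

theorem exists_sigmaSq_eq {F : ℝ → ℝ} (hF : IsDistributionFunction F) {s t : ℝ}
    (hs : 0 < s) (ht : 0 < t) (hst : s < 1 - t) :
    ∃ A : ℝ, (∀ x < A, F x ≤ s) ∧
      sigmaSq F s t = ∫ x in Ioc A (quantile F (1 - t)), ∫ y in Ioc A (quantile F (1 - t)),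
        (min (F x) (F y) - F x * F y) := by
  obtain ⟨A, hA, h⟩ := exists_lsMeasure_restrict_eq_map hF hs ht hst
  have hFm : Measurable F := hF.mono.measurable
  refine ⟨A, hA, ?_⟩
  have hK : Continuous fun p : ℝ × ℝ => min p.1 p.2 - p.1 * p.2 := by fun_prop
  rw [sigmaSq, h, integral_map hFm.aemeasurable]
  · congr 1
    ext x
    rw [integral_map hFm.aemeasurable]
    exact Continuous.aestronglyMeasurable (by fun_prop)
  · exact (hK.stronglyMeasurable.integral_prod_right).aestronglyMeasurable

/-- The double integral of the covariance kernel as an iterated integral over a triangle. -/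
theorem integral_covariance_kernel_eq {F : ℝ → ℝ} (hF : IsDistributionFunction F) (A B : ℝ) :
    ∫ x in Ioc A B, ∫ y in Ioc A B, (min (F x) (F y) - F x * F y) =
      2 * ∫ y in Ioc A B, (1 - F y) * ∫ x in Ioc A y, F x := by
  have hFm : Measurable F := hF.mono.measurable
  have h0 := hF.nonneg
  have h1 := hF.le_one
  set μ := volume.restrict (Ioc A B) with hμ
  have hms : MeasurableSet {p : ℝ × ℝ | p.1 ≤ p.2} := measurableSet_le measurable_fst measurable_snd
  have hφint : Integrable ({p : ℝ × ℝ | p.1 ≤ p.2}.indicator fun p => F p.1 * (1 - F p.2))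
      (μ.prod μ) := by
    refine Integrable.indicator ?_ hms
    refine Integrable.of_bound (C := 1) ?_ (Eventually.of_forall fun p => ?_)
    · exact ((hFm.comp measurable_fst).mul (measurable_const.sub (hFm.comp measurable_snd))).aestronglyMeasurable
    · rw [Real.norm_of_nonneg (mul_nonneg (h0 _) (by linarith [h1 p.2]))]
      nlinarith [h0 p.1, h0 p.2, h1 p.1, h1 p.2]
  have hφint' := hφint.swap
  set φ : ℝ × ℝ → ℝ := {p : ℝ × ℝ | p.1 ≤ p.2}.indicator fun p => F p.1 * (1 - F p.2) with hφ
  have hsplit : ∀ x, ∫ y, (min (F x) (F y) - F x * F y) ∂μ = ∫ y, (φ (x, y) + φ (y, x)) ∂μ := by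
    intro x
    refine integral_congr_ae ?_
    have hne : ∀ᵐ y ∂μ, y ≠ x := compl_mem_ae_iff.2 (measure_singleton x)
    filter_upwards [hne] with y hy
    rcases lt_or_gt_of_ne hy with h | h
    · have := hF.mono h.le
      simp only [hφ, indicator, mem_ofPred_eq, not_le.2 h, h.le, if_true, if_false, min_eq_right this]
      ring
    · have := hF.mono h.le
      simp only [hφ, indicator, mem_ofPred_eq, not_le.2 h, h.le, if_true, if_false, min_eq_left this]
      ring
  have hsum : ∫ x, ∫ y, (φ (x, y) + φ (y, x)) ∂μ ∂μ
      = (∫ x, ∫ y, φ (x, y) ∂μ ∂μ) + ∫ x, ∫ y, φ (y, x) ∂μ ∂μ :=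
    integral_integral_add hφint hφint'
  have hswap : ∫ x, ∫ y, φ (x, y) ∂μ ∂μ = ∫ y, ∫ x, φ (x, y) ∂μ ∂μ :=
    integral_integral_swap (f := fun x y => φ (x, y)) hφint
  simp_rw [hsplit]
  rw [hsum, hswap, ← two_mul]
  congr 1
  refine setIntegral_congr_fun measurableSet_Ioc fun y hy => ?_
  have : ∀ x, φ (x, y) = (Iic y).indicator (fun x => (1 - F y) * F x) x := by
    intro x
    simp only [hφ, indicator, mem_ofPred_eq, mem_Iic, mul_comm]
  simp only [this]
  rw [integral_indicator measurableSet_Iic, integral_const_mul, hμ,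
    Measure.restrict_restrict measurableSet_Iic]
  have : Iic y ∩ Ioc A B = Ioc A y := by
    ext z; simp only [mem_inter_iff, mem_Iic, mem_Ioc]
    exact ⟨fun h => ⟨h.2.1, h.1⟩, fun h => ⟨h.2, h.1, h.2.trans hy.2⟩⟩
  rw [this]

theorem tendsto_mul_rpow_of_second_order {g : ℝ → ℝ} {c α b β : ℝ} (hc : 0 < c) (hβ : 0 < β)
    (h : Tendsto (fun x : ℝ => (g x / (c * x ^ (-α)) - 1) * x ^ β) atTop (𝓝 b)) :
    Tendsto (fun x => g x * x ^ α) atTop (𝓝 c) := by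
  have h1 := ((h.mul (tendsto_rpow_neg_atTop hβ)).add_const 1).const_mul c
  rw [mul_zero, zero_add, mul_one] at h1
  refine h1.congr' ?_
  filter_upwards [eventually_gt_atTop 0] with x hx
  rw [Real.rpow_neg hx.le, Real.rpow_neg hx.le]
  have := Real.rpow_pos_of_pos hx β
  have := Real.rpow_pos_of_pos hx α
  field_simp
  ring

theorem exists_forall_le_mul_rpow_neg {g : ℝ → ℝ} {c α : ℝ} (h1 : ∀ x, g x ≤ 1) (hα : 0 < α)
    (h : Tendsto (fun x => g x * x ^ α) atTop (𝓝 c)) :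
    ∃ C, 0 < C ∧ ∀ x, 0 < x → g x ≤ C * x ^ (-α) := by
  have he := h.eventually_le_const (lt_add_one c)
  obtain ⟨N, hN⟩ := eventually_atTop.1 he
  refine ⟨max (c + 1) ((max N 1) ^ α), lt_max_of_lt_right (by positivity), fun x hx => ?_⟩
  have hxα := Real.rpow_pos_of_pos hx α
  rw [Real.rpow_neg hx.le, ← div_eq_mul_inv, le_div_iff₀ hxα]
  rcases le_total N x with hNx | hNx
  · exact (hN x hNx).trans (le_max_left _ _)
  · refine le_trans ?_ (le_max_right _ _)
    calc g x * x ^ α ≤ 1 * x ^ α := by gcongr; exact h1 x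
      _ = x ^ α := one_mul _
      _ ≤ _ := Real.rpow_le_rpow hx.le (hNx.trans (le_max_left _ _)) hα.le

theorem integrableOn_Ioi_of_le_rpow_neg {g : ℝ → ℝ} {C p : ℝ} (hg : Measurable g)
    (h0 : ∀ x, 0 ≤ g x) (h1 : ∀ x, g x ≤ 1) (hp : 1 < p)
    (h : ∀ x, 0 < x → g x ≤ C * x ^ (-p)) : IntegrableOn g (Ioi 0) := by
  rw [← Ioc_union_Ioi_eq_Ioi zero_le_one]
  refine IntegrableOn.union ?_ ?_
  · refine Integrable.of_bound (C := 1) hg.aestronglyMeasurable (Eventually.of_forall fun x => ?_)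
    rw [Real.norm_of_nonneg (h0 x)]; exact h1 x
  · refine Integrable.mono' ((integrableOn_Ioi_rpow_of_lt (a := -p) (by linarith) one_pos).const_mul C)
      hg.aestronglyMeasurable ?_
    filter_upwards [ae_restrict_mem measurableSet_Ioi] with x hx
    rw [Real.norm_of_nonneg (h0 x)]
    exact h x (one_pos.trans hx)

theorem integrableOn_sqrt_Iic {F : ℝ → ℝ} {c α : ℝ} (hF : IsDistributionFunction F) (hα : 2 < α)
    (h : Tendsto (fun x => F (-x) * x ^ α) atTop (𝓝 c)) :
    IntegrableOn (fun x => √(F x)) (Iic 0) := by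
  obtain ⟨C, hC, hb⟩ := exists_forall_le_mul_rpow_neg (fun x => hF.le_one (-x)) (by linarith) h
  have hm : Measurable fun x => √(F x) := hF.mono.measurable.sqrt
  have h1 : IntegrableOn (fun x => √(F (-x))) (Ioi 0) := by
    refine integrableOn_Ioi_of_le_rpow_neg (C := √C) (p := α / 2) (hm.comp measurable_neg)
      (fun x => Real.sqrt_nonneg _) (fun x => Real.sqrt_le_one.2 (hF.le_one _)) (by linarith)
      fun x hx => ?_
    refine (Real.sqrt_le_sqrt (hb x hx)).trans_eq ?_
    rw [Real.sqrt_mul hC.le, Real.sqrt_eq_rpow (x ^ (-α)), ← Real.rpow_mul hx.le]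
    congr 2; ring
  rw [integrableOn_Iic_iff_integrableOn_Iio]
  have h2 := (Measure.measurePreserving_neg (volume : Measure ℝ)).integrableOn_comp_preimage
    (Homeomorph.neg ℝ).measurableEmbedding (f := fun x => √(F x)) (s := Iio 0)
  refine h2.1 ?_
  simpa [Function.comp_def] using h1

theorem tendsto_integral_mul_div_rpow {g : ℝ → ℝ} {c α : ℝ} (hg : Measurable g)
    (h0 : ∀ x, 0 ≤ g x) (h1 : ∀ x, g x ≤ 1) (hα : 0 < α) (hα2 : α < 2)
    (h : Tendsto (fun x => g x * x ^ α) atTop (𝓝 c)) :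
    Tendsto (fun B : ℝ => (∫ y in Ioc 0 B, y * g y) / B ^ (2 - α)) atTop (𝓝 (c / (2 - α))) := by
  obtain ⟨C, hC, hb⟩ := exists_forall_le_mul_rpow_neg h1 hα h
  have key : Tendsto (fun B : ℝ => ∫ z in (0 : ℝ)..1, z * g (B * z) * B ^ α) atTop
      (𝓝 (∫ z in (0 : ℝ)..1, c * z ^ (1 - α))) := by
    refine intervalIntegral.tendsto_integral_filter_of_dominated_convergence
      (fun z => C * z ^ (1 - α)) ?_ ?_ ?_ ?_
    · exact Eventually.of_forall fun B => Measurable.aestronglyMeasurable (by fun_prop)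
    · filter_upwards [eventually_gt_atTop 0] with B hB
      refine Eventually.of_forall fun z hz => ?_
      rw [uIoc_of_le zero_le_one] at hz
      have hz0 := hz.1
      have hBα := Real.rpow_pos_of_pos hB α
      rw [Real.norm_of_nonneg (mul_nonneg (mul_nonneg hz0.le (h0 _)) hBα.le)]
      calc z * g (B * z) * B ^ α ≤ z * (C * (B * z) ^ (-α)) * B ^ α := by
            gcongr; exact hb _ (by positivity)
        _ = C * z ^ (1 - α) := by
            rw [Real.mul_rpow hB.le hz0.le, Real.rpow_neg hB.le, sub_eq_add_neg,
              Real.rpow_add hz0, Real.rpow_one]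
            field_simp
    · exact (intervalIntegral.intervalIntegrable_rpow' (by linarith)).const_mul C
    · refine Eventually.of_forall fun z hz => ?_
      rw [uIoc_of_le zero_le_one] at hz
      have hz0 := hz.1
      have h2 : Tendsto (fun B : ℝ => B * z) atTop atTop := tendsto_id.atTop_mul_const hz0
      refine ((h.comp h2).mul_const (z ^ (1 - α))).congr' ?_
      filter_upwards [eventually_gt_atTop 0] with B hB
      simp only [Function.comp]
      rw [Real.mul_rpow hB.le hz0.le, sub_eq_add_neg, Real.rpow_add hz0, Real.rpow_one,
        Real.rpow_neg hz0.le]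
      have := Real.rpow_pos_of_pos hz0 α
      field_simp
  have hval : ∫ z in (0 : ℝ)..1, c * z ^ (1 - α) = c / (2 - α) := by
    rw [intervalIntegral.integral_const_mul, integral_rpow (Or.inl (by linarith)),
      Real.one_rpow, Real.zero_rpow (by linarith)]
    ring_nf
  rw [hval] at key
  refine key.congr' ?_
  filter_upwards [eventually_gt_atTop 0] with B hB
  have h3 := intervalIntegral.smul_integral_comp_mul_left (a := 0) (b := 1) (fun y => y * g y) B
  rw [mul_zero, mul_one, intervalIntegral.integral_of_le hB.le] at h3
  rw [← h3, smul_eq_mul, ← intervalIntegral.integral_const_mul, ← intervalIntegral.integral_div]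
  refine intervalIntegral.integral_congr fun z _ => ?_
  have : B ^ (2 - α) = B ^ 2 / B ^ α := by
    rw [Real.rpow_sub hB]; norm_num
  simp only [this]
  have := Real.rpow_pos_of_pos hB α
  field_simp

theorem tendsto_quantile_one_sub_atTop {F : ℝ → ℝ} (hF : IsDistributionFunction F)
    (hlt : ∀ x, F x < 1) : Tendsto (fun t => quantile F (1 - t)) (𝓝[>] 0) atTop := by
  refine tendsto_atTop.2 fun M => ?_
  have hM : 0 < 1 - F M := by linarith [hlt M]
  filter_upwards [Ioo_mem_nhdsGT hM] with t ht
  by_contra! h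
  linarith [le_of_quantile_lt hF (by linarith [ht.1]) h, ht.2]

theorem tendsto_mul_quantile_rpow {F : ℝ → ℝ} {c α : ℝ} (hF : IsDistributionFunction F)
    (hlt : ∀ x, F x < 1) (h : Tendsto (fun x => (1 - F x) * x ^ α) atTop (𝓝 c)) :
    Tendsto (fun t => t * quantile F (1 - t) ^ α) (𝓝[>] 0) (𝓝 c) := by
  have hB := tendsto_quantile_one_sub_atTop hF hlt
  have aux : ∀ d : ℝ, Tendsto (fun B : ℝ => (1 - F (B + d)) * B ^ α) atTop (𝓝 c) := by
    intro d
    have h1 : Tendsto (fun B : ℝ => B + d) atTop atTop := tendsto_atTop_add_const_right _ d tendsto_id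
    have h2 : Tendsto (fun B : ℝ => (1 - d / (B + d)) ^ α) atTop (𝓝 1) := by
      have h3 : Tendsto (fun B : ℝ => 1 - d / (B + d)) atTop (𝓝 1) := by
        simpa using (h1.const_div_atTop d).const_sub 1
      simpa using h3.rpow_const (p := α) (Or.inl one_ne_zero)
    have h4 := (h.comp h1).mul h2
    rw [mul_one] at h4
    refine h4.congr' ?_
    filter_upwards [eventually_gt_atTop 0, eventually_gt_atTop (-d)] with B hB hBd
    have hpos : 0 < B + d := by linarith
    have h5 : 1 - d / (B + d) = B / (B + d) := by field_simp; ring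
    simp only [Function.comp, h5]
    rw [Real.div_rpow hB.le hpos.le]
    have := Real.rpow_pos_of_pos hpos α
    field_simp
  have hlow := (aux 1).comp hB
  have hup := (aux (-1)).comp hB
  have hBpos := hB.eventually_gt_atTop 0
  have ht : ∀ᶠ t : ℝ in 𝓝[>] 0, t ∈ Ioo (0 : ℝ) 1 := Ioo_mem_nhdsGT one_pos
  refine tendsto_of_tendsto_of_tendsto_of_le_of_le' hlow hup ?_ ?_
  · filter_upwards [hBpos, ht] with t hBt ht
    simp only [Function.comp]
    gcongr
    linarith [le_of_quantile_lt hF (u := 1 - t) (by linarith [ht.1]) (lt_add_one (quantile F (1 - t)))]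
  · filter_upwards [hBpos, ht] with t hBt ht
    simp only [Function.comp]
    gcongr
    by_contra! hlt'
    have := quantile_le_of_le hF (u := 1 - t) (x := quantile F (1 - t) + -1) (by linarith [ht.2]) (by linarith)
    linarith

/-- If `√F` is integrable at `-∞` and `1 - F` at `∞`, then the covariance integral over `(A, B]²`
is `2 ∫₀ᴮ y (1 - F y) dy` up to a bounded error. -/
theorem exists_abs_integral_covariance_sub_le {F : ℝ → ℝ} (hF : IsDistributionFunction F)
    (hL : IntegrableOn (fun x => √(F x)) (Iic 0)) (hR : IntegrableOn (fun x => 1 - F x) (Ioi 0)) :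
    ∃ C, ∀ A B : ℝ, A ≤ 0 → 0 ≤ B →
      |(∫ x in Ioc A B, ∫ y in Ioc A B, (min (F x) (F y) - F x * F y)) -
        2 * ∫ y in Ioc 0 B, y * (1 - F y)| ≤ C := by
  have hFm : Measurable F := hF.mono.measurable
  have h0 := hF.nonneg
  have h1 := hF.le_one
  set J := ∫ x in Iic 0, √(F x) with hJ
  set T := ∫ x in Ioi 0, (1 - F x) with hT
  have hJ0 : 0 ≤ J := integral_nonneg fun x => Real.sqrt_nonneg _
  have hT0 : 0 ≤ T := integral_nonneg fun x => by simp only [Pi.zero_apply]; linarith [h1 x]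
  have hFint : ∀ a b : ℝ, IntervalIntegrable F volume a b := fun a b =>
    hF.mono.intervalIntegrable
  refine ⟨2 * (J * J + (J + T) * T), fun A B hA hB => ?_⟩
  rw [integral_covariance_kernel_eq hF]
  set G : ℝ → ℝ := fun y => ∫ x in Ioc A y, F x with hG
  have hGcont : ContinuousOn G (Icc A B) := by
    have h : ContinuousOn (fun y => ∫ x in A..y, F x) (Icc A B) :=
      (intervalIntegral.continuous_primitive hFint A).continuousOn
    refine h.congr fun y hy => ?_
    simp only [hG, intervalIntegral.integral_of_le hy.1]
  have hG0 : ∀ y, 0 ≤ G y := fun y => integral_nonneg fun x => h0 x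
  have hGneg : ∀ y ≤ 0, G y ≤ J * √(F y) := by
    intro y hy
    calc G y ≤ ∫ x in Ioc A y, √(F x) * √(F y) := by
          refine setIntegral_mono_on ?_ ?_ measurableSet_Ioc fun x hx => ?_
          · exact (hF.mono.locallyIntegrable.integrableOn_isCompact isCompact_Icc).mono_set Ioc_subset_Icc_self
          · exact (hL.mono_set (Ioc_subset_Iic_self.trans (Iic_subset_Iic.2 hy))).mul_const _
          · calc F x = √(F x) * √(F x) := (Real.mul_self_sqrt (h0 x)).symm
              _ ≤ √(F x) * √(F y) := by gcongr; exact hF.mono hx.2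
      _ = (∫ x in Ioc A y, √(F x)) * √(F y) := integral_mul_const _ _
      _ ≤ J * √(F y) := by
          gcongr
          exact setIntegral_mono_set hL (Eventually.of_forall fun x => Real.sqrt_nonneg _)
            (Ioc_subset_Iic_self.trans (Iic_subset_Iic.2 hy)).eventuallyLE
  have hG00 : G 0 ≤ J := (hGneg 0 le_rfl).trans
    (mul_le_of_le_one_right hJ0 (Real.sqrt_le_one.2 (h1 0)))
  have hGpos : ∀ y, 0 ≤ y → |G y - y| ≤ J + T := by
    intro y hy
    have e1 : G y = G 0 + ∫ x in (0 : ℝ)..y, F x := by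
      simp only [hG]
      rw [← intervalIntegral.integral_of_le (hA.trans hy), ← intervalIntegral.integral_of_le hA,
        intervalIntegral.integral_add_adjacent_intervals (hFint _ _) (hFint _ _)]
    have e2 : ∫ x in (0 : ℝ)..y, (1 - F x) = y - ∫ x in (0 : ℝ)..y, F x := by
      rw [intervalIntegral.integral_sub (by simp) (hFint _ _)]; simp
    have e3 : ∫ x in (0 : ℝ)..y, (1 - F x) ≤ T := by
      rw [intervalIntegral.integral_of_le hy]
      exact setIntegral_mono_set hR (Eventually.of_forall fun x => by
        simp only [Pi.zero_apply]; linarith [h1 x]) Ioc_subset_Ioi_self.eventuallyLE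
    have e4 : 0 ≤ ∫ x in (0 : ℝ)..y, (1 - F x) :=
      intervalIntegral.integral_nonneg hy fun x _ => by linarith [h1 x]
    rw [abs_le]
    constructor <;> linarith [hG0 0]
  have hbd : ∀ x, ‖1 - F x‖ ≤ 1 := fun x => by
    rw [Real.norm_of_nonneg (by linarith [h1 x])]; linarith [h0 x]
  have hFm' : AEStronglyMeasurable (fun y => 1 - F y) (volume.restrict (Ioc A B)) :=
    (measurable_const.sub hFm).aestronglyMeasurable
  have hGi : IntegrableOn G (Ioc A B) :=
    (hGcont.integrableOn_compact isCompact_Icc).mono_set Ioc_subset_Icc_self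
  have hH : IntegrableOn (fun y => (1 - F y) * G y) (Ioc A B) :=
    hGi.bdd_mul hFm' (Eventually.of_forall hbd)
  have hY : IntegrableOn (fun y => y * (1 - F y)) (Ioc A B) := by
    have : IntegrableOn (fun y : ℝ => y) (Ioc A B) :=
      (continuous_id.integrableOn_Icc).mono_set Ioc_subset_Icc_self
    exact this.mul_bdd hFm' (Eventually.of_forall hbd)
  have hsplit : ∫ y in Ioc A B, (1 - F y) * G y =
      (∫ y in Ioc A 0, (1 - F y) * G y) + ∫ y in Ioc 0 B, (1 - F y) * G y := by
    rw [← setIntegral_union (Ioc_disjoint_Ioc_of_le le_rfl) measurableSet_Ioc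
      (hH.mono_set (Ioc_subset_Ioc_right hB)) (hH.mono_set (Ioc_subset_Ioc_left hA)),
      Ioc_union_Ioc_eq_Ioc hA hB]
  have hneg0 : 0 ≤ ∫ y in Ioc A 0, (1 - F y) * G y :=
    integral_nonneg fun y => mul_nonneg (by linarith [h1 y]) (hG0 y)
  have hneg1 : ∫ y in Ioc A 0, (1 - F y) * G y ≤ J * J := by
    calc ∫ y in Ioc A 0, (1 - F y) * G y ≤ ∫ y in Ioc A 0, J * √(F y) := by
          refine setIntegral_mono_on (hH.mono_set (Ioc_subset_Ioc_right hB))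
            ((hL.mono_set Ioc_subset_Iic_self).const_mul J) measurableSet_Ioc fun y hy => ?_
          exact (mul_le_of_le_one_left (hG0 y) (by linarith [h0 y])).trans (hGneg y hy.2)
      _ = J * ∫ y in Ioc A 0, √(F y) := integral_const_mul _ _
      _ ≤ J * J := by
          gcongr
          exact setIntegral_mono_set hL (Eventually.of_forall fun x => Real.sqrt_nonneg _)
            Ioc_subset_Iic_self.eventuallyLE
  have hdiff : |(∫ y in Ioc 0 B, (1 - F y) * G y) - ∫ y in Ioc 0 B, y * (1 - F y)| ≤
      (J + T) * T := by
    rw [← integral_sub (hH.mono_set (Ioc_subset_Ioc_left hA)) (hY.mono_set (Ioc_subset_Ioc_left hA))]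
    calc |∫ y in Ioc 0 B, ((1 - F y) * G y - y * (1 - F y))|
        ≤ ∫ y in Ioc 0 B, (J + T) * (1 - F y) := by
          rw [← Real.norm_eq_abs]
          refine norm_integral_le_of_norm_le ((hR.mono_set Ioc_subset_Ioi_self).const_mul _) ?_
          filter_upwards [ae_restrict_mem measurableSet_Ioc] with y hy
          have : (1 - F y) * G y - y * (1 - F y) = (G y - y) * (1 - F y) := by ring
          rw [this, norm_mul, Real.norm_eq_abs, Real.norm_of_nonneg (by linarith [h1 y])]
          exact mul_le_mul_of_nonneg_right (hGpos y hy.1.le) (by linarith [h1 y])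
      _ = (J + T) * ∫ y in Ioc 0 B, (1 - F y) := integral_const_mul _ _
      _ ≤ (J + T) * T := by
          gcongr
          exact setIntegral_mono_set hR (Eventually.of_forall fun x => by
            simp only [Pi.zero_apply]; linarith [h1 x]) Ioc_subset_Ioi_self.eventuallyLE
  rw [hsplit, ← mul_sub, abs_mul, abs_two]
  refine mul_le_mul_of_nonneg_left ?_ zero_le_two
  rw [abs_le] at hdiff ⊢
  constructor <;> linarith [hdiff.1, hdiff.2, mul_nonneg hJ0 hJ0]

/-- under the second-order tail conditions with `α_R < 2` and `α_L > 2`,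
there is a strictly positive finite constant `C_R`, depending only on `c_R` and `α_R`,
such that `σ²(m/n, k/n) / (k/n)^(1 - 2/α_R) → C_R` as `n → ∞`. -/
theorem sigmaSq_ratio_tendsto_of_lt_two_gt_two
    (cR αR : ℝ) (hcR : 0 < cR) (hαR1 : 1 < αR) (hαR2 : αR < 2) :
    ∃ CR : ℝ, 0 < CR ∧
      ∀ (F : ℝ → ℝ) (cL bR bL αL βR βL : ℝ) (m k : ℕ → ℕ),
        IsDistributionFunction F →
        0 < cL → bR ≠ 0 → bL ≠ 0 → 0 < βR → 0 < βL → 1 < αL →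
        RightTailSecondOrder F cR αR bR βR →
        LeftTailSecondOrder F cL αL bL βL →
        2 < αL →
        Tendsto m atTop atTop →
        Tendsto (fun n : ℕ => (m n : ℝ) / n) atTop (nhds 0) →
        Tendsto k atTop atTop →
        Tendsto (fun n : ℕ => (k n : ℝ) / n) atTop (nhds 0) →
        Tendsto
          (fun n : ℕ =>
            sigmaSq F ((m n : ℝ) / n) ((k n : ℝ) / n) /
              ((k n : ℝ) / n) ^ (1 - 2 / αR))
          atTop (nhds CR) := by
  refine ⟨2 * (cR / (2 - αR)) * cR ^ ((2 - αR) / αR), ?_, ?_⟩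
  · have : 0 < 2 - αR := by linarith
    positivity
  intro F cL bR bL αL βR βL m k hF hcL _ _ hβR hβL _ hRT hLT hαL hm hmn hk hkn
  have hR := tendsto_mul_rpow_of_second_order (g := fun x => 1 - F x) hcR hβR hRT
  have hL := tendsto_mul_rpow_of_second_order (g := fun x => F (-x)) hcL hβL hLT
  have hα0 : 0 < αR := by linarith
  have hgm : Measurable fun x => 1 - F x := measurable_const.sub hF.mono.measurable
  have hlt : ∀ x, F x < 1 := by
    intro x
    obtain ⟨y, hy, hxy, hy0⟩ := ((hR.eventually_const_lt hcR).and
      ((eventually_ge_atTop x).and (eventually_gt_atTop 0))).exists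
    have := pos_of_mul_pos_left hy (Real.rpow_nonneg hy0.le _)
    linarith [hF.mono hxy]
  have hpos : 0 < F 0 := by
    obtain ⟨y, hy, hy0⟩ := ((hL.eventually_const_lt hcL).and (eventually_gt_atTop 0)).exists
    have := pos_of_mul_pos_left hy (Real.rpow_nonneg hy0.le _)
    linarith [hF.mono (show -y ≤ 0 by linarith)]
  have hg0 : ∀ x, 0 ≤ 1 - F x := fun x => by linarith [hF.le_one x]
  have hg1 : ∀ x, 1 - F x ≤ 1 := fun x => by linarith [hF.nonneg x]
  obtain ⟨K, -, hK⟩ := exists_forall_le_mul_rpow_neg hg1 hα0 hR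
  obtain ⟨C, hC⟩ := exists_abs_integral_covariance_sub_le hF (integrableOn_sqrt_Iic hF hαL hL)
    (integrableOn_Ioi_of_le_rpow_neg hgm hg0 hg1 hαR1 hK)
  have hpos_div : ∀ j : ℕ → ℕ, Tendsto j atTop atTop → ∀ᶠ n : ℕ in atTop, 0 < (j n : ℝ) / n := by
    intro j hj
    filter_upwards [hj.eventually_gt_atTop 0, eventually_gt_atTop 0] with n h1 h2
    positivity
  have ht : Tendsto (fun n : ℕ => (k n : ℝ) / n) atTop (𝓝[>] 0) :=
    tendsto_nhdsWithin_iff.2 ⟨hkn, hpos_div k hk⟩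
  set t : ℕ → ℝ := fun n => (k n : ℝ) / n with htdef
  set B : ℕ → ℝ := fun n => quantile F (1 - t n) with hBdef
  have hB : Tendsto B atTop atTop := (tendsto_quantile_one_sub_atTop hF hlt).comp ht
  have hBα : Tendsto (fun n => t n * B n ^ αR) atTop (𝓝 cR) :=
    (tendsto_mul_quantile_rpow hF hlt hR).comp ht
  have hI := (tendsto_integral_mul_div_rpow hgm hg0 hg1 hα0 hαR2 hR).comp hB
  set I : ℝ → ℝ := fun b => ∫ y in Ioc 0 b, y * (1 - F y) with hIdef
  have herr : Tendsto (fun n => (sigmaSq F ((m n : ℝ) / n) (t n) - 2 * I (B n)) *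
      (B n ^ (2 - αR))⁻¹) atTop (𝓝 0) := by
    refine bdd_le_mul_tendsto_zero' C ?_
      ((tendsto_rpow_atTop (by linarith)).comp hB).inv_tendsto_atTop
    filter_upwards [hpos_div m hm, hpos_div k hk, hmn.eventually_lt_const (half_pos one_pos),
      hkn.eventually_lt_const (half_pos one_pos), hmn.eventually_lt_const hpos,
      hB.eventually_ge_atTop 0] with n hs ht hs2 ht2 hsF hB0
    have hst : (m n : ℝ) / n < 1 - t n := by simp only [htdef]; linarith
    obtain ⟨A, hA, hEq⟩ := exists_sigmaSq_eq hF hs ht hst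
    rw [hEq]
    refine hC A (B n) ?_ hB0
    by_contra! h
    linarith [hA 0 h]
  have hratio : Tendsto (fun n => B n ^ (2 - αR) / t n ^ (1 - 2 / αR)) atTop
      (𝓝 (cR ^ ((2 - αR) / αR))) := by
    refine (hBα.rpow_const (p := (2 - αR) / αR) (Or.inl hcR.ne')).congr' ?_
    filter_upwards [hpos_div k hk, hB.eventually_gt_atTop 0] with n ht hB0
    rw [Real.mul_rpow (le_of_lt ht) (Real.rpow_nonneg hB0.le _), ← Real.rpow_mul hB0.le,
      mul_div_cancel₀ _ hα0.ne', mul_comm, div_eq_mul_inv (B n ^ (2 - αR)),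
      ← Real.rpow_neg (le_of_lt ht)]
    have he : (2 - αR) / αR = -(1 - 2 / αR) := by field_simp; ring
    rw [he]
  have hfin := (herr.add (hI.const_mul 2)).mul hratio
  rw [zero_add] at hfin
  refine hfin.congr' ?_
  filter_upwards [hB.eventually_gt_atTop 0] with n hB0
  have := (Real.rpow_pos_of_pos hB0 (2 - αR)).ne'
  change ((sigmaSq F ((m n : ℝ) / n) (t n) - 2 * I (B n)) * (B n ^ (2 - αR))⁻¹ +
    2 * (I (B n) / B n ^ (2 - αR))) * (B n ^ (2 - αR) / t n ^ (1 - 2 / αR)) =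
    sigmaSq F ((m n : ℝ) / n) (t n) / t n ^ (1 - 2 / αR)
  generalize sigmaSq F ((m n : ℝ) / n) (t n) = S
  field_simp
  ring
end

section
/- Suppose F satisfies the second-order tail conditions with α_R = 2 and α_L < 2, and suppose in addition that B₀ n^{l₀} ≤ m ≤ B₁ n^{l₁} and B₀ n^{l₀} ≤ k ≤ B₁ n^{l₁} for some constants B₀ > 0, B₁ > 0 and 0 < l₀ ≤ l₁ < 1. Then ∫_{1/2}^{1−k/n} [F⁻(s)]² ds / (m/n)^{1−2/α_L} → 0 as n → ∞. -/
open Filter Set Topology MeasureTheory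

/-- A second-order tail condition implies an eventual power bound on the tail. -/
theorem RightTailSecondOrder.eventually_le {F : ℝ → ℝ} {c α b β : ℝ} (hc : 0 < c) (hβ : 0 < β)
    (h : RightTailSecondOrder F c α b β) :
    ∀ᶠ x : ℝ in atTop, 1 - F x ≤ 2 * c * x ^ (-α) := by
  have h1 := h.mul (tendsto_rpow_neg_atTop hβ)
  rw [mul_zero] at h1
  filter_upwards [h1.eventually_lt_const one_pos, eventually_gt_atTop 0] with x hx hx0
  rw [mul_assoc, ← Real.rpow_add hx0, add_neg_cancel, Real.rpow_zero, mul_one] at hx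
  have hp : 0 < c * x ^ (-α) := mul_pos hc (Real.rpow_pos_of_pos hx0 _)
  have h2 : (1 - F x) / (c * x ^ (-α)) < 2 := by linarith
  rw [div_lt_iff₀ hp] at h2
  linarith

/-- If the right tail of `F` is `O(x⁻²)`, then `(F⁻ s)² = O((1 - s)⁻¹)` on `[1/2, 1)`. -/
theorem exists_quantile_sq_le {F : ℝ → ℝ} {c : ℝ} (hF : IsDistributionFunction F) (hc : 0 < c)
    (h : ∀ᶠ x : ℝ in atTop, 1 - F x ≤ c * x ^ (-2 : ℝ)) :
    ∃ C : ℝ, 0 < C ∧ ∀ s : ℝ, 1 / 2 ≤ s → s < 1 → quantile F s ^ 2 ≤ C * (1 - s)⁻¹ := by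
  obtain ⟨L, hL, hL0⟩ := ((hF.tendsto_atBot.eventually_lt_const
    (by norm_num : (0 : ℝ) < 1 / 2)).and (eventually_le_atBot 0)).exists
  obtain ⟨x₀, hx₀⟩ := eventually_atTop.1 h
  have hx₀' : ∀ x, |x₀| + 1 ≤ x → 1 - F x ≤ c * x ^ (-2 : ℝ) := fun x hx ↦
    hx₀ x (by linarith [le_abs_self x₀])
  refine ⟨(|x₀| + 1) ^ 2 + c + L ^ 2, by positivity, fun s hs hs1 ↦ ?_⟩
  have hs' : 0 < 1 - s := by linarith
  have hinv : 1 ≤ (1 - s)⁻¹ := (one_le_inv₀ hs').2 (by linarith)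
  set r := √((|x₀| + 1) ^ 2 + c * (1 - s)⁻¹) with hr
  have hrsq : r ^ 2 = (|x₀| + 1) ^ 2 + c * (1 - s)⁻¹ := Real.sq_sqrt (by positivity)
  have hxr : |x₀| + 1 ≤ r := Real.le_sqrt_of_sq_le (by
    have : 0 ≤ c * (1 - s)⁻¹ := by positivity
    linarith)
  have hr0 : 0 < r := lt_of_lt_of_le (by positivity) hxr
  have hmem : s ≤ F r := by
    have h1 := hx₀' r hxr
    have h2 : c * r ^ (-2 : ℝ) ≤ 1 - s := by
      rw [Real.rpow_neg hr0.le, Real.rpow_two, ← div_eq_mul_inv, div_le_iff₀ (by positivity),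
        hrsq, mul_add, mul_left_comm, mul_inv_cancel₀ hs'.ne', mul_one]
      have : 0 ≤ (1 - s) * (|x₀| + 1) ^ 2 := by positivity
      linarith
    linarith
  have hlow : ∀ x ∈ {x : ℝ | s ≤ F x}, L ≤ x := by
    intro x hx
    by_contra! hlt
    have := hF.mono hlt.le
    have hx' : s ≤ F x := hx
    linarith
  have hqr : quantile F s ≤ r := csInf_le ⟨L, hlow⟩ hmem
  have hLq : L ≤ quantile F s := le_csInf ⟨r, hmem⟩ hlow
  have hq : quantile F s ^ 2 ≤ r ^ 2 + L ^ 2 := by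
    rcases le_total 0 (quantile F s) with h0 | h0 <;> nlinarith
  have hb : (|x₀| + 1) ^ 2 + L ^ 2 ≤ ((|x₀| + 1) ^ 2 + L ^ 2) * (1 - s)⁻¹ :=
    le_mul_of_one_le_right (by positivity) hinv
  nlinarith

theorem integral_inv_one_sub {t : ℝ} (ht : 0 < t) :
    ∫ s in (1 / 2 : ℝ)..(1 - t), (1 - s)⁻¹ = Real.log (1 / 2 / t) := by
  rw [intervalIntegral.integral_comp_sub_left (fun s : ℝ ↦ s⁻¹) (1 : ℝ), sub_sub_cancel,
    integral_inv_of_pos ht (by norm_num)]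
  norm_num

/-- If `(F⁻ s)² ≤ C / (1 - s)`, the truncated second moment grows at most logarithmically. -/
theorem abs_integral_quantile_sq_le {F : ℝ → ℝ} {C t : ℝ}
    (h : ∀ s : ℝ, 1 / 2 ≤ s → s < 1 → quantile F s ^ 2 ≤ C * (1 - s)⁻¹)
    (ht : 0 < t) (ht' : t ≤ 1 / 2) :
    |∫ s in (1 / 2 : ℝ)..(1 - t), quantile F s ^ 2| ≤ |C * Real.log (1 / 2 / t)| := by
  have hle : (1 / 2 : ℝ) ≤ 1 - t := by linarith
  rw [← integral_inv_one_sub ht, ← intervalIntegral.integral_const_mul]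
  refine (intervalIntegral.norm_integral_le_of_norm_le (μ := volume)
    (f := fun s ↦ quantile F s ^ 2) (g := fun s ↦ C * (1 - s)⁻¹) hle
    (.of_forall fun s hs ↦ ?_) ?_).trans (le_abs_self _)
  · rw [Real.norm_of_nonneg (sq_nonneg _)]
    exact h s hs.1.le (by linarith [hs.2])
  · refine ContinuousOn.intervalIntegrable (continuousOn_const.mul
      ((continuousOn_const.sub continuousOn_id).inv₀ fun s hs ↦ ?_))
    rw [uIcc_of_le hle] at hs
    have : 0 < 1 - s := by linarith [hs.2]
    exact this.ne'

/-- under the second-order tail conditions with `α_R = 2` and `α_L < 2`,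
if in addition `B₀ n^(l₀) ≤ m ≤ B₁ n^(l₁)` and `B₀ n^(l₀) ≤ k ≤ B₁ n^(l₁)` for some
`B₀ > 0`, `B₁ > 0`, `0 < l₀ ≤ l₁ < 1`, then
`∫_{1/2}^{1-k/n} [F⁻(s)]² ds / (m/n)^(1 - 2/α_L) → 0` as `n → ∞`. -/
theorem integral_ratio_tendsto_zero_of_eq_two_lt_two
    (F : ℝ → ℝ) (cR cL bR bL αR αL βR βL : ℝ)
    (hF : IsDistributionFunction F)
    (hcR : 0 < cR) (hcL : 0 < cL) (hbR : bR ≠ 0) (hbL : bL ≠ 0)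
    (hβR : 0 < βR) (hβL : 0 < βL) (hαR1 : 1 < αR) (hαL1 : 1 < αL)
    (htailR : RightTailSecondOrder F cR αR bR βR)
    (htailL : LeftTailSecondOrder F cL αL bL βL)
    (hαR : αR = 2) (hαL : αL < 2)
    (m k : ℕ → ℕ)
    (hm_top : Tendsto m atTop atTop)
    (hm_frac : Tendsto (fun n : ℕ => (m n : ℝ) / n) atTop (nhds 0))
    (hk_top : Tendsto k atTop atTop)
    (hk_frac : Tendsto (fun n : ℕ => (k n : ℝ) / n) atTop (nhds 0))
    (B₀ B₁ l₀ l₁ : ℝ) (hB₀ : 0 < B₀) (hB₁ : 0 < B₁)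
    (hl₀ : 0 < l₀) (hl₀₁ : l₀ ≤ l₁) (hl₁ : l₁ < 1)
    (hbound : ∀ n : ℕ,
      B₀ * (n : ℝ) ^ l₀ ≤ (m n : ℝ) ∧ (m n : ℝ) ≤ B₁ * (n : ℝ) ^ l₁ ∧
      B₀ * (n : ℝ) ^ l₀ ≤ (k n : ℝ) ∧ (k n : ℝ) ≤ B₁ * (n : ℝ) ^ l₁) :
    Tendsto
      (fun n : ℕ =>
        (∫ s in (1 / 2 : ℝ)..(1 - (k n : ℝ) / n), (quantile F s) ^ 2) /
          ((m n : ℝ) / n) ^ (1 - 2 / αL))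
      atTop (nhds 0) := by
  subst hαR
  obtain ⟨C, hC, hq⟩ := exists_quantile_sq_le hF (by positivity : 0 < 2 * cR)
    (htailR.eventually_le hcR hβR)
  have hδ : 0 < 2 / αL - 1 := by
    rw [sub_pos, one_lt_div (by linarith)]
    exact hαL
  set δ := 2 / αL - 1 with hδ_def
  have hε : 0 < (1 - l₁) * δ := mul_pos (by linarith) hδ
  have hlim : Tendsto (fun n : ℕ ↦
      C * B₁ ^ δ * (Real.log (n : ℝ) / (n : ℝ) ^ ((1 - l₁) * δ))) atTop (nhds 0) := by
    simpa using (((isLittleO_log_rpow_atTop hε).tendsto_div_nhds_zero).comp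
      tendsto_natCast_atTop_atTop).const_mul (C * B₁ ^ δ)
  refine squeeze_zero_norm' ?_ hlim
  filter_upwards [eventually_ge_atTop 1, hk_top.eventually_ge_atTop 1,
    hk_frac.eventually_le_const (by norm_num : (0 : ℝ) < 1 / 2)] with n hn hk hkn
  have hn0 : (0 : ℝ) < n := by exact_mod_cast hn
  have hk1 : (1 : ℝ) ≤ k n := by exact_mod_cast hk
  have ht : 0 < (k n : ℝ) / n := by positivity
  have hint := abs_integral_quantile_sq_le hq ht hkn
  have hlog0 : 0 ≤ Real.log (1 / 2 / ((k n : ℝ) / n)) :=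
    Real.log_nonneg ((one_le_div ht).2 hkn)
  have hlog : Real.log (1 / 2 / ((k n : ℝ) / n)) ≤ Real.log n := by
    apply Real.log_le_log (by positivity)
    rw [div_div_eq_mul_div, div_le_iff₀ (by positivity)]
    nlinarith
  rw [abs_of_nonneg (mul_nonneg hC.le hlog0)] at hint
  have hmn : ((m n : ℝ) / n) ^ δ ≤ B₁ ^ δ / (n : ℝ) ^ ((1 - l₁) * δ) := by
    calc ((m n : ℝ) / n) ^ δ ≤ (B₁ * (n : ℝ) ^ l₁ / n) ^ δ := by
          gcongr
          exact (hbound n).2.1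
      _ = (B₁ / (n : ℝ) ^ (1 - l₁)) ^ δ := by
          rw [Real.rpow_sub hn0, Real.rpow_one, div_div_eq_mul_div]
      _ = _ := by
          rw [Real.div_rpow hB₁.le (by positivity), ← Real.rpow_mul hn0.le]
  have hexp : 1 - 2 / αL = -δ := by rw [hδ_def]; ring
  rw [hexp, Real.rpow_neg (by positivity), div_inv_eq_mul, norm_mul, Real.norm_eq_abs,
    Real.norm_of_nonneg (by positivity : 0 ≤ ((m n : ℝ) / n) ^ δ)]
  calc _ ≤ (C * Real.log n) * (B₁ ^ δ / (n : ℝ) ^ ((1 - l₁) * δ)) := by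
        gcongr
        exact hint.trans (by gcongr)
    _ = _ := by ring
end
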